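/- Let n ≥ 2 be an integer, ρ ∈ (0,1) fixed, and a_n = 3(n-1)/(n+1). For c > 0 set r_c = 1 + 2ρ²/(c(1-ρ²)). Then as c → ∞: c·(r_c²-1) tends to 4ρ²/(1-ρ²), and c²·(r_c²-1)^{-n+1}·P_{n,c}(r_c) tends to (4ρ²/(1-ρ²)²)·(1 + a_nρ²). (These are the limits of the metric coefficients γ² and β² of g_c, identifying the limit metric g_∞.) -/

import Mathlib

open Real Filter Set

/-- `Q k r = r * ∫_1^r t⁻²(t²-1)^k dt`. -/
noncomputable def Q (k : ℕ) (r : ℝ) : ℝ :=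
  r * ∫ t in (1:ℝ)..r, (t ^ 2 - 1) ^ k / t ^ 2

/-- `P_{n,c} = (2n-1)Q_n + (2n/c)Q_{n-1}`. -/
noncomputable def P (n : ℕ) (c r : ℝ) : ℝ :=
  (2 * (n : ℝ) - 1) * Q n r + (2 * (n : ℝ) / c) * Q (n - 1) r

theorem integral_mul_sq_sub_one_pow (k : ℕ) (r : ℝ) :
    ∫ t in (1:ℝ)..r, t * (t ^ 2 - 1) ^ k = (r ^ 2 - 1) ^ (k + 1) / (2 * ((k : ℝ) + 1)) := by
  have hk : (k : ℝ) + 1 ≠ 0 := by positivity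
  have hderiv : ∀ t ∈ uIcc (1:ℝ) r,
      HasDerivAt (fun t : ℝ => (t ^ 2 - 1) ^ (k + 1) / (2 * ((k : ℝ) + 1)))
        (t * (t ^ 2 - 1) ^ k) t := by
    intro t _
    have h := ((((hasDerivAt_id t).pow 2).sub_const 1).pow (k + 1)).div_const (2 * ((k : ℝ) + 1))
    refine h.congr_deriv ?_
    simp
    field_simp
  rw [intervalIntegral.integral_eq_sub_of_hasDerivAt hderiv
    (Continuous.intervalIntegrable (by fun_prop) _ _)]
  simp

theorem intervalIntegrable_Q_integrand (k : ℕ) {r : ℝ} (hr : 1 ≤ r) :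
    IntervalIntegrable (fun t : ℝ => (t ^ 2 - 1) ^ k / t ^ 2) MeasureTheory.volume 1 r := by
  refine ContinuousOn.intervalIntegrable ?_
  rw [uIcc_of_le hr]
  refine ContinuousOn.div (by fun_prop) (by fun_prop) fun t ht => ?_
  have : 0 < t := by linarith [ht.1]
  positivity

theorem Q_le (k : ℕ) {r : ℝ} (hr : 1 ≤ r) :
    Q k r ≤ r * ((r ^ 2 - 1) ^ (k + 1) / (2 * ((k : ℝ) + 1))) := by
  rw [← integral_mul_sq_sub_one_pow]
  refine mul_le_mul_of_nonneg_left ?_ (by linarith)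
  refine intervalIntegral.integral_mono_on hr (intervalIntegrable_Q_integrand k hr)
    (Continuous.intervalIntegrable (by fun_prop) _ _) fun t ht => ?_
  have ht1 : 1 ≤ t := ht.1
  have hpow : 0 ≤ (t ^ 2 - 1) ^ k := pow_nonneg (by nlinarith) k
  calc (t ^ 2 - 1) ^ k / t ^ 2 ≤ (t ^ 2 - 1) ^ k := div_le_self hpow (one_le_pow₀ ht1)
    _ ≤ t * (t ^ 2 - 1) ^ k := le_mul_of_one_le_left hpow ht1

theorem le_Q (k : ℕ) {r : ℝ} (hr : 1 ≤ r) :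
    (r ^ 2)⁻¹ * ((r ^ 2 - 1) ^ (k + 1) / (2 * ((k : ℝ) + 1))) ≤ Q k r := by
  have hr0 : 0 < r := by linarith
  have hmono : ∫ t in (1:ℝ)..r, (r ^ 3)⁻¹ * (t * (t ^ 2 - 1) ^ k) ≤
      ∫ t in (1:ℝ)..r, (t ^ 2 - 1) ^ k / t ^ 2 := by
    refine intervalIntegral.integral_mono_on hr (Continuous.intervalIntegrable (by fun_prop) _ _)
      (intervalIntegrable_Q_integrand k hr) fun t ht => ?_
    have ht1 : 1 ≤ t := ht.1
    have ht0 : 0 < t := by linarith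
    have hpow : 0 ≤ (t ^ 2 - 1) ^ k := pow_nonneg (by nlinarith) k
    have hinv : (r ^ 3)⁻¹ ≤ (t ^ 3)⁻¹ :=
      inv_anti₀ (by positivity) (pow_le_pow_left₀ ht0.le ht.2 3)
    calc (r ^ 3)⁻¹ * (t * (t ^ 2 - 1) ^ k) ≤ (t ^ 3)⁻¹ * (t * (t ^ 2 - 1) ^ k) :=
          mul_le_mul_of_nonneg_right hinv (by positivity)
      _ = (t ^ 2 - 1) ^ k / t ^ 2 := by field_simp
  rw [intervalIntegral.integral_const_mul, integral_mul_sq_sub_one_pow] at hmono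
  refine le_trans (le_of_eq ?_) (mul_le_mul_of_nonneg_left hmono hr0.le)
  field_simp

theorem tendsto_Q_div_pow (k : ℕ) :
    Tendsto (fun r : ℝ => Q k r / (r ^ 2 - 1) ^ (k + 1)) (nhdsWithin 1 (Ioi 1))
      (nhds (1 / (2 * ((k : ℝ) + 1)))) := by
  have hlow : Tendsto (fun r : ℝ => (r ^ 2)⁻¹ * (1 / (2 * ((k : ℝ) + 1))))
      (nhdsWithin 1 (Ioi 1)) (nhds (1 / (2 * ((k : ℝ) + 1)))) := by
    have : ContinuousAt (fun r : ℝ => (r ^ 2)⁻¹ * (1 / (2 * ((k : ℝ) + 1)))) 1 :=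
      ((continuousAt_id.pow 2).inv₀ (by simp)).mul continuousAt_const
    simpa using this.tendsto.mono_left nhdsWithin_le_nhds
  have hupp : Tendsto (fun r : ℝ => r * (1 / (2 * ((k : ℝ) + 1))))
      (nhdsWithin 1 (Ioi 1)) (nhds (1 / (2 * ((k : ℝ) + 1)))) := by
    have : ContinuousAt (fun r : ℝ => r * (1 / (2 * ((k : ℝ) + 1)))) 1 :=
      continuousAt_id.mul continuousAt_const
    simpa using this.tendsto.mono_left nhdsWithin_le_nhds
  refine tendsto_of_tendsto_of_tendsto_of_le_of_le' hlow hupp ?_ ?_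
  · filter_upwards [self_mem_nhdsWithin] with r hr
    have hr1 : 1 < r := hr
    have hpos : 0 < (r ^ 2 - 1) ^ (k + 1) := pow_pos (by nlinarith) _
    rw [le_div_iff₀ hpos]
    exact le_trans (le_of_eq (by ring)) (le_Q k hr1.le)
  · filter_upwards [self_mem_nhdsWithin] with r hr
    have hr1 : 1 < r := hr
    have hpos : 0 < (r ^ 2 - 1) ^ (k + 1) := pow_pos (by nlinarith) _
    rw [div_le_iff₀ hpos]
    exact (Q_le k hr1.le).trans (le_of_eq (by ring))

theorem sq_mul_zpow_mul_P {n : ℕ} (hn : 1 ≤ n) {c r : ℝ} (hc : c ≠ 0) (hr : r ^ 2 - 1 ≠ 0) :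
    c ^ 2 * (r ^ 2 - 1) ^ (-(n : ℤ) + 1) * P n c r =
      (2 * (n : ℝ) - 1) * (Q n r / (r ^ 2 - 1) ^ (n + 1)) * (c * (r ^ 2 - 1)) ^ 2 +
        2 * (n : ℝ) * (Q (n - 1) r / (r ^ 2 - 1) ^ (n - 1 + 1)) * (c * (r ^ 2 - 1)) := by
  rw [P, Nat.sub_add_cancel hn, zpow_add₀ hr, zpow_neg, zpow_natCast, zpow_one]
  field_simp
  ring

theorem tendsto_mul_sq_sub_one (m : ℝ) :
    Tendsto (fun c : ℝ => c * ((1 + m / c) ^ 2 - 1)) atTop (nhds (2 * m)) := by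
  have h : Tendsto (fun c : ℝ => 2 * m + m ^ 2 / c) atTop (nhds (2 * m + 0)) :=
    tendsto_const_nhds.add (tendsto_const_nhds.div_atTop tendsto_id)
  rw [add_zero] at h
  refine h.congr' ?_
  filter_upwards [eventually_ne_atTop 0] with c hc
  field_simp
  ring

theorem tendsto_sq_mul_zpow_mul_P {n : ℕ} (hn : 1 ≤ n) {m : ℝ} (hm : 0 < m) :
    Tendsto (fun c : ℝ => c ^ 2 * ((1 + m / c) ^ 2 - 1) ^ (-(n : ℤ) + 1) * P n c (1 + m / c))
      atTop (nhds (2 * (2 * (n : ℝ) - 1) / ((n : ℝ) + 1) * m ^ 2 + 2 * m)) := by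
  have hr : Tendsto (fun c : ℝ => 1 + m / c) atTop (nhdsWithin 1 (Ioi 1)) := by
    refine tendsto_nhdsWithin_iff.2 ⟨?_, ?_⟩
    · simpa using (tendsto_const_nhds (x := (1 : ℝ))).add
        ((tendsto_const_nhds (x := m)).div_atTop tendsto_id)
    · filter_upwards [eventually_gt_atTop 0] with c hc
      exact lt_add_of_pos_right _ (div_pos hm hc)
  have hu := tendsto_mul_sq_sub_one m
  have hlim := ((((tendsto_Q_div_pow n).comp hr).const_mul (2 * (n : ℝ) - 1)).mul (hu.pow 2)).add
    ((((tendsto_Q_div_pow (n - 1)).comp hr).const_mul (2 * (n : ℝ))).mul hu)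
  have hn0 : (n : ℝ) ≠ 0 := by positivity
  have hn1 : (n : ℝ) + 1 ≠ 0 := by positivity
  convert hlim.congr' ?_ using 2
  · rw [Nat.cast_sub hn]
    push_cast
    rw [sub_add_cancel]
    field_simp
  · filter_upwards [eventually_gt_atTop 0] with c hc
    have hpos : 0 < m / c := div_pos hm hc
    exact (sq_mul_zpow_mul_P hn hc.ne' (by nlinarith)).symm

/-- With `r_c = 1 + 2ρ²/(c(1-ρ²))`, as `c → ∞`: `c(r_c²-1) → 4ρ²/(1-ρ²)` and
`c²(r_c²-1)^(-n+1)P_{n,c}(r_c) → (4ρ²/(1-ρ²)²)(1 + a_nρ²)` where `a_n = 3(n-1)/(n+1)`. -/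
theorem stmt_15 (n : ℕ) (hn : 2 ≤ n) (ρ : ℝ) (hρ : ρ ∈ Set.Ioo (0 : ℝ) 1)
    (a : ℝ) (ha : a = 3 * ((n : ℝ) - 1) / ((n : ℝ) + 1)) :
    Tendsto (fun c : ℝ => c * ((1 + 2 * ρ ^ 2 / (c * (1 - ρ ^ 2))) ^ 2 - 1))
      atTop (nhds (4 * ρ ^ 2 / (1 - ρ ^ 2))) ∧
    Tendsto (fun c : ℝ =>
        c ^ 2 * ((1 + 2 * ρ ^ 2 / (c * (1 - ρ ^ 2))) ^ 2 - 1) ^ (-(n : ℤ) + 1)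
          * P n c (1 + 2 * ρ ^ 2 / (c * (1 - ρ ^ 2))))
      atTop (nhds ((4 * ρ ^ 2 / (1 - ρ ^ 2) ^ 2) * (1 + a * ρ ^ 2))) := by
  have hρ2 : 0 < 1 - ρ ^ 2 := by nlinarith [hρ.1, hρ.2]
  have hm : 0 < 2 * ρ ^ 2 / (1 - ρ ^ 2) := div_pos (by nlinarith [hρ.1]) hρ2
  have hdiv (c : ℝ) : 2 * ρ ^ 2 / (c * (1 - ρ ^ 2)) = 2 * ρ ^ 2 / (1 - ρ ^ 2) / c := by
    rw [div_div, mul_comm c]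
  simp only [hdiv]
  constructor
  · convert tendsto_mul_sq_sub_one (2 * ρ ^ 2 / (1 - ρ ^ 2)) using 2
    ring
  · convert tendsto_sq_mul_zpow_mul_P (by omega : 1 ≤ n) hm using 2
    have hn1 : (n : ℝ) + 1 ≠ 0 := by positivity
    rw [ha]
    field_simp
    ring
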